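/- Let d ≥ m_1 ≥ m_2 ≥ … ≥ m_9 ≥ 0 be integers with 2d ≥ m_1 + m_2 + m_3 + m_4. In the lattice L' = ℤ^{11} (the case n = 2, r = 10) with basis h, e_1, …, e_10, let z := (2d−m_1)h − (d−m_1)e_1 − (d−m_1)e_2 − m_2e_3 − m_3e_4 − … − m_9e_10. Then ⟨z, w(e_j)⟩ ≥ 0 for every w ∈ W' and every j ∈ {1, …, 10}. (Lattice form of the Proposition of Section 6: the restriction D|_Q of a standard class D on the blow-up of P³ to the quadric Q through the first nine points has non-negative intersection with every (−1)-curve of Q, the (−1)-classes being the W'-orbit of the exceptional classes.) -/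

import Mathlib

open BigOperators Finset

/-- The lattice `L = ℤ^{1+r}`: coordinates with respect to the basis `H, E₁, …, E_r`. -/
abbrev PicL (r : ℕ) := Fin (r + 1) → ℤ

/-- `cls r d m` is the class `d·H - ∑ᵢ mᵢ·Eᵢ`. -/
def cls (r : ℕ) (d : ℤ) (m : Fin r → ℤ) : PicL r :=
  Fin.cases d (fun i => -(m i))

/-- The bilinear form determined by `⟨H,H⟩ = n-1`, `⟨Eᵢ,Eᵢ⟩ = -1`,
`⟨H,Eᵢ⟩ = ⟨Eᵢ,E_j⟩ = 0` for `i ≠ j`. -/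
def bil (n r : ℕ) (x y : PicL r) : ℤ :=
  ((n : ℤ) - 1) * x 0 * y 0 - ∑ i : Fin r, x i.succ * y i.succ

/-- The exceptional class `E_j`. -/
def Ecl (r : ℕ) (j : Fin r) : PicL r := cls r 0 (fun i => if i = j then -1 else 0)

/-- `F = H - E₁ - ⋯ - E_{n+1}`. -/
def Fcl (n r : ℕ) : PicL r := cls r 1 (fun i => if (i : ℕ) < n + 1 then 1 else 0)

/-- `F_k = E_k - E_{k+1}` (zero-based index `k`). -/
def Fdiff (r k : ℕ) : PicL r :=
  cls r 0 (fun i => if (i : ℕ) = k then -1 else if (i : ℕ) = k + 1 then 1 else 0)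

/-- The reflection `σ_R(D) = D + ⟨D,R⟩·R`. -/
def reflect (n r : ℕ) (R D : PicL r) : PicL r := D + bil n r D R • R

/-- The Weyl group `W`: subgroup of the `ℤ`-linear automorphisms of `L` generated by
`σ_F` and the `σ_{F_k}`, `1 ≤ k ≤ r-1`. -/
def Wgrp (n r : ℕ) : Subgroup ((PicL r) ≃ₗ[ℤ] (PicL r)) :=
  Subgroup.closure
    {w | (∀ D, w D = reflect n r (Fcl n r) D) ∨
         ∃ k, k + 1 < r ∧ ∀ D, w D = reflect n r (Fdiff r k) D}

/-- The multiplicity vector `(d-m₁, d-m₁, m₂, …, m₉)` of the restriction `D|_Q`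
written in the plane basis of `Pic(Q)` (indices are zero-based). -/
def restMult (d : ℤ) (m : Fin 9 → ℤ) : Fin 10 → ℤ :=
  fun j => if h : (j : ℕ) ≤ 1 then d - m 0
    else m ⟨(j : ℕ) - 1, by have := j.isLt; omega⟩

/-- `d·h - ∑ mᵢ·eᵢ` is a nonzero isotropic class orthogonal to `K = -3h + ∑ eᵢ`, in the forward
light cone. -/
structure IsForwardIsotropic (d : ℤ) (m : Fin 10 → ℤ) : Prop where
  pos : 0 < d
  sum_eq : ∑ i, m i = 3 * d
  sum_sq_eq : ∑ i, m i ^ 2 = d ^ 2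

/-- The class `D·h - ∑ nᵢ·eᵢ` is non-negative on `K + x` for every forward isotropic class `x`
orthogonal to `K`. -/
def NonnegOnExceptional (D : ℤ) (n : Fin 10 → ℤ) : Prop :=
  ∀ d m, IsForwardIsotropic d m → 0 ≤ D * (d - 3) - ∑ i, n i * (m i - 1)

/-- The Cremona reflection, in the root `h - ∑ χᵢ·eᵢ` with `χ` the indicator of a triple,
preserves forward isotropic classes. -/
lemma IsForwardIsotropic.cremona {d : ℤ} {m : Fin 10 → ℤ} (hx : IsForwardIsotropic d m)
    {χ : Fin 10 → ℤ} (hχ : ∀ i, χ i ^ 2 = χ i) (hsum : ∑ i, χ i = 3)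
    {s : ℤ} (hs : s = d - ∑ i, χ i * m i) :
    IsForwardIsotropic (d + s) (fun i => m i + s * χ i) := by
  obtain ⟨hpos, hlin, hsq⟩ := hx
  refine ⟨?_, ?_, ?_⟩
  · have hcs := Finset.sum_mul_sq_le_sq_mul_sq Finset.univ χ m
    simp only [hχ, hsum, hsq] at hcs
    by_contra! hneg
    nlinarith
  · rw [Finset.sum_add_distrib, ← Finset.mul_sum, hlin, hsum]
    ring
  · have expand : ∀ i, (m i + s * χ i) ^ 2 = m i ^ 2 + 2 * s * (χ i * m i) + s ^ 2 * χ i := by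
      intro i
      linear_combination s ^ 2 * hχ i
    simp only [expand, Finset.sum_add_distrib, ← Finset.mul_sum, hsq, hsum]
    linear_combination 2 * s * hs

lemma IsForwardIsotropic.comp_perm {d : ℤ} {m : Fin 10 → ℤ} (hx : IsForwardIsotropic d m)
    (p : Equiv.Perm (Fin 10)) : IsForwardIsotropic d (m ∘ p) :=
  ⟨hx.pos, (Equiv.sum_comp p m).trans hx.sum_eq,
    (Equiv.sum_comp p (fun i => m i ^ 2)).trans hx.sum_sq_eq⟩

lemma sum_mul_comp_swap {ι : Type*} [Fintype ι] [DecidableEq ι] (n m : ι → ℤ) {a b : ι}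
    (hab : a ≠ b) :
    ∑ i, n i * m (Equiv.swap a b i) = ∑ i, n i * m i + (n a - n b) * (m b - m a) := by
  have pointwise : ∀ i, n i * m (Equiv.swap a b i) =
      n i * m i + ((if i = a then n i * (m b - m a) else 0)
        - (if i = b then n i * (m b - m a) else 0)) := by
    intro i
    rcases eq_or_ne i a with rfl | hia
    · simp [hab]
      ring
    · rcases eq_or_ne i b with rfl | hib
      · simp [hia]
        ring
      · simp [hia, hib, Equiv.swap_apply_of_ne_of_ne]
  simp only [pointwise, Finset.sum_add_distrib, Finset.sum_sub_distrib, Finset.sum_ite_eq',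
    Finset.mem_univ, if_true]
  ring

/-- The pairing with the strictly dominant vector `25h - 9e₁ - 8e₂ - ⋯ - e₉` is positive on the
forward light cone. -/
lemma IsForwardIsotropic.height_pos {d : ℤ} {m : Fin 10 → ℤ} (hx : IsForwardIsotropic d m) :
    0 < 25 * d - ∑ i : Fin 10, (9 - (i : ℤ)) * m i := by
  have hcs := Finset.sum_mul_sq_le_sq_mul_sq Finset.univ (fun i : Fin 10 => 9 - (i : ℤ)) m
  have hnorm : ∑ i : Fin 10, (9 - (i : ℤ)) ^ 2 = 285 := by decide
  rw [hx.sum_sq_eq, hnorm] at hcs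
  have := hx.pos
  by_contra! hneg
  nlinarith

/-- The only dominant forward isotropic classes are the multiples of `3h - e₁ - ⋯ - e₉`. -/
lemma IsForwardIsotropic.eq_of_dominant {d : ℤ} {m : Fin 10 → ℤ} (hx : IsForwardIsotropic d m)
    (hm : Antitone m) (hd : m 0 + m 1 + m 2 ≤ d) :
    ∃ c : ℤ, 1 ≤ c ∧ d = 3 * c ∧ ∀ i, m i = if i = 9 then 0 else c := by
  obtain ⟨hpos, hlin, hsq⟩ := hx
  obtain ⟨c0, h0⟩ := Int.le.dest hd
  obtain ⟨c1, h1⟩ := Int.le.dest (hm (show (0 : Fin 10) ≤ 1 by decide))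
  obtain ⟨c2, h2⟩ := Int.le.dest (hm (show (1 : Fin 10) ≤ 2 by decide))
  obtain ⟨c3, h3⟩ := Int.le.dest (hm (show (2 : Fin 10) ≤ 3 by decide))
  obtain ⟨c4, h4⟩ := Int.le.dest (hm (show (3 : Fin 10) ≤ 4 by decide))
  obtain ⟨c5, h5⟩ := Int.le.dest (hm (show (4 : Fin 10) ≤ 5 by decide))
  obtain ⟨c6, h6⟩ := Int.le.dest (hm (show (5 : Fin 10) ≤ 6 by decide))
  obtain ⟨c7, h7⟩ := Int.le.dest (hm (show (6 : Fin 10) ≤ 7 by decide))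
  obtain ⟨c8, h8⟩ := Int.le.dest (hm (show (7 : Fin 10) ≤ 8 by decide))
  obtain ⟨c9, h9⟩ := Int.le.dest (hm (show (8 : Fin 10) ≤ 9 by decide))
  simp only [Fin.sum_univ_castSucc, Fin.sum_univ_zero, zero_add] at hlin hsq
  change m 0 + m 1 + m 2 + m 3 + m 4 + m 5 + m 6 + m 7 + m 8 + m 9 = 3 * d at hlin
  change m 0 ^ 2 + m 1 ^ 2 + m 2 ^ 2 + m 3 ^ 2 + m 4 ^ 2 + m 5 ^ 2 + m 6 ^ 2 + m 7 ^ 2 + m 8 ^ 2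
    + m 9 ^ 2 = d ^ 2 at hsq
  have e9 : m 9 = 3 * c0 + 2 * c1 + 4 * c2 + 6 * c3 + 5 * c4 + 4 * c5 + 3 * c6 + 2 * c7 + c8 := by
    linarith
  have e8 : m 8 = m 9 + c9 := by linarith
  have e7 : m 7 = m 9 + c9 + c8 := by linarith
  have e6 : m 6 = m 9 + c9 + c8 + c7 := by linarith
  have e5 : m 5 = m 9 + c9 + c8 + c7 + c6 := by linarith
  have e4 : m 4 = m 9 + c9 + c8 + c7 + c6 + c5 := by linarith
  have e3 : m 3 = m 9 + c9 + c8 + c7 + c6 + c5 + c4 := by linarith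
  have e2 : m 2 = m 9 + c9 + c8 + c7 + c6 + c5 + c4 + c3 := by linarith
  have e1 : m 1 = m 9 + c9 + c8 + c7 + c6 + c5 + c4 + c3 + c2 := by linarith
  have e0 : m 0 = m 9 + c9 + c8 + c7 + c6 + c5 + c4 + c3 + c2 + c1 := by linarith
  have ed : d = m 0 + m 1 + m 2 + c0 := h0.symm
  clear h0 h1 h2 h3 h4 h5 h6 h7 h8 h9
  have rest : (0 : ℤ) ≤ d ^ 2 - (m 0 ^ 2 + m 1 ^ 2 + m 2 ^ 2 + m 3 ^ 2 + m 4 ^ 2 + m 5 ^ 2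
      + m 6 ^ 2 + m 7 ^ 2 + m 8 ^ 2 + m 9 ^ 2)
      - (c0 + c1 + c2 + c3 + c4 + c5 + c6 + c7 + c8 : ℤ) ^ 2 := by
    rw [ed, e0, e1, e2, e3, e4, e5, e6, e7, e8, e9]
    ring_nf
    exact_mod_cast Nat.zero_le _
  rw [hsq, sub_self, zero_sub, neg_nonneg] at rest
  have hzero : (c0 + c1 + c2 + c3 + c4 + c5 + c6 + c7 + c8 : ℤ) = 0 :=
    pow_eq_zero_iff two_ne_zero |>.mp (le_antisymm rest (sq_nonneg _))
  refine ⟨c9, by omega, by omega, fun i => ?_⟩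
  fin_cases i <;> simp <;> omega

/-- A dominant class with non-negative multiplicities is non-negative on exceptional classes. -/
lemma nonnegOnExceptional_of_antitone {D : ℤ} {n : Fin 10 → ℤ} (hn : Antitone n)
    (h9 : 0 ≤ n 9) (hD : n 0 + n 1 + n 2 ≤ D) : NonnegOnExceptional D n := by
  intro d m hx
  induction hN : (25 * d - ∑ i : Fin 10, (9 - (i : ℤ)) * m i).toNat using
    Nat.strong_induction_on generalizing d m with
  | _ N ih =>
  subst hN
  have hheight := hx.height_pos
  by_cases hm : Antitone m
  · by_cases hs : m 0 + m 1 + m 2 ≤ d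
    · obtain ⟨c, hc, rfl, hmc⟩ := hx.eq_of_dominant hm hs
      simp only [Fin.sum_univ_castSucc, Fin.sum_univ_zero, zero_add, hmc]
      change 0 ≤ D * (3 * c - 3) - (n 0 * (c - 1) + n 1 * (c - 1) + n 2 * (c - 1) + n 3 * (c - 1)
        + n 4 * (c - 1) + n 5 * (c - 1) + n 6 * (c - 1) + n 7 * (c - 1) + n 8 * (c - 1)
        + n 9 * (0 - 1))
      have hle : ∀ i j : Fin 10, i ≤ j → n j ≤ n i := fun i j hij => hn hij
      have h3 := hle 0 3 (by decide)
      have h4 := hle 1 4 (by decide)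
      have h5 := hle 2 5 (by decide)
      have h6 := hle 0 6 (by decide)
      have h7 := hle 1 7 (by decide)
      have h8 := hle 2 8 (by decide)
      have hf : 0 ≤ 3 * D - (n 0 + n 1 + n 2 + n 3 + n 4 + n 5 + n 6 + n 7 + n 8) := by linarith
      nlinarith [mul_nonneg (sub_nonneg.mpr hc) hf]
    · set χ : Fin 10 → ℤ := fun i => if i = 0 ∨ i = 1 ∨ i = 2 then 1 else 0 with hχ
      have hχsum : ∀ f : Fin 10 → ℤ, ∑ i, f i * χ i = f 0 + f 1 + f 2 := by
        intro f
        simp [hχ, Fin.sum_univ_succ, add_assoc]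
      set s : ℤ := d - (m 0 + m 1 + m 2) with hs'
      have hy := hx.cremona (χ := χ) (s := s) (by decide) (by decide)
        (by simp only [mul_comm (χ _), hχsum, hs'])
      have hsum : ∀ f : Fin 10 → ℤ,
          ∑ i, f i * (m i + s * χ i) = ∑ i, f i * m i + s * (f 0 + f 1 + f 2) := by
        intro f
        rw [← hχsum, Finset.mul_sum, ← Finset.sum_add_distrib]
        exact Finset.sum_congr rfl fun i _ => by ring
      have hlt : (25 * (d + s) - ∑ i : Fin 10, (9 - (i : ℤ)) * (m i + s * χ i)).toNat
          < (25 * d - ∑ i : Fin 10, (9 - (i : ℤ)) * m i).toNat := by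
        rw [hsum]
        simp
        omega
      have hrec := ih _ hlt _ _ hy rfl
      simp only [mul_sub, Finset.sum_sub_distrib, hsum] at hrec ⊢
      nlinarith
  · obtain ⟨k, hk⟩ : ∃ k : Fin 9, m k.castSucc < m k.succ := by
      by_contra! hcon
      exact hm (Fin.antitone_iff_succ_le.mpr hcon)
    have hne : k.castSucc ≠ k.succ := k.castSucc_lt_succ.ne
    have hy := hx.comp_perm (Equiv.swap k.castSucc k.succ)
    have hlt : (25 * d - ∑ i : Fin 10, (9 - (i : ℤ)) *
          (m ∘ Equiv.swap k.castSucc k.succ) i).toNat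
        < (25 * d - ∑ i : Fin 10, (9 - (i : ℤ)) * m i).toNat := by
      have := sum_mul_comp_swap (fun i : Fin 10 => 9 - (i : ℤ)) m hne
      simp only [Function.comp_apply, this, Fin.val_castSucc, Fin.val_succ]
      push_cast
      ring_nf
      ring_nf at hheight
      omega
    have hrec := ih _ hlt _ _ hy rfl
    have hpair := sum_mul_comp_swap n m hne
    simp only [mul_sub, Finset.sum_sub_distrib, Function.comp_apply, hpair] at hrec ⊢
    nlinarith [mul_nonneg (sub_nonneg.mpr (hn k.castSucc_lt_succ.le)) (sub_nonneg.mpr hk.le)]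

lemma NonnegOnExceptional.of_comp_perm {D : ℤ} {n : Fin 10 → ℤ} (p : Equiv.Perm (Fin 10))
    (h : NonnegOnExceptional D (n ∘ p)) : NonnegOnExceptional D n := by
  intro d m hx
  have := h d (m ∘ p) (hx.comp_perm p)
  rwa [← Equiv.sum_comp p (fun i => n i * (m i - 1))]

lemma nonnegOnExceptional_of_triple_le {D : ℤ} {n : Fin 10 → ℤ} (hn : ∀ i, 0 ≤ n i)
    (hD : ∀ i j k, i ≠ j → i ≠ k → j ≠ k → n i + n j + n k ≤ D) : NonnegOnExceptional D n := by
  set p := Tuple.sort (fun i => -n i)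
  have hmono : Monotone ((fun i => -n i) ∘ p) := Tuple.monotone_sort _
  refine .of_comp_perm p (nonnegOnExceptional_of_antitone ?_ (hn _) ?_)
  · exact fun i j hij => neg_le_neg_iff.mp (hmono hij)
  · exact hD _ _ _ (p.injective.ne (by decide)) (p.injective.ne (by decide))
      (p.injective.ne (by decide))

/-- Non-negativity may be checked after a Cremona reflection. -/
lemma NonnegOnExceptional.of_cremona {D : ℤ} {n χ : Fin 10 → ℤ} (hχ : ∀ i, χ i ^ 2 = χ i)
    (hsum : ∑ i, χ i = 3) {t : ℤ} (ht : t = D - ∑ i, χ i * n i)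
    (h : NonnegOnExceptional (D + t) (fun i => n i + t * χ i)) : NonnegOnExceptional D n := by
  intro d m hx
  have hrec := h _ _ (hx.cremona hχ hsum rfl)
  set s := d - ∑ i, χ i * m i with hs
  have expand : ∀ i, (n i + t * χ i) * (m i + s * χ i - 1) =
      n i * (m i - 1) + s * (χ i * n i) + t * (χ i * m i) + t * (s - 1) * χ i := by
    intro i
    linear_combination t * s * hχ i
  simp only [expand, Finset.sum_add_distrib, ← Finset.mul_sum, hsum] at hrec
  have hn : ∑ i, χ i * n i = D - t := by linarith
  have hm : ∑ i, χ i * m i = d - s := by linarith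
  rw [hn, hm] at hrec
  linarith

/-- The class `y` is `K + x` for a forward isotropic class `x` orthogonal to `K`. -/
def IsExceptionalType (y : PicL 10) : Prop :=
  IsForwardIsotropic (y 0 + 3) (fun i => 1 - y i.succ)

lemma isExceptionalType_Ecl (j : Fin 10) : IsExceptionalType (Ecl 10 j) := by
  refine ⟨?_, ?_, ?_⟩ <;> revert j <;> decide

lemma IsExceptionalType.reflect_Fcl {y : PicL 10} (hy : IsExceptionalType y) :
    IsExceptionalType (reflect 2 10 (Fcl 2 10) y) := by
  have h := IsForwardIsotropic.cremona hy (χ := fun i => if (i : ℕ) < 3 then 1 else 0)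
    (by decide) (by decide) rfl
  unfold IsExceptionalType
  convert h using 1
  · simp [reflect, bil, Fcl, cls, Fin.sum_univ_succ]
    ring
  · funext i
    simp [reflect, bil, Fcl, cls, Fin.sum_univ_succ]
    split_ifs <;> ring

lemma IsExceptionalType.reflect_Fdiff {y : PicL 10} (hy : IsExceptionalType y) {k : ℕ}
    (hk : k + 1 < 10) : IsExceptionalType (reflect 2 10 (Fdiff 10 k) y) := by
  have h := IsForwardIsotropic.comp_perm hy (Equiv.swap ⟨k, by omega⟩ ⟨k + 1, hk⟩)
  unfold IsExceptionalType
  have hbil : bil 2 10 y (Fdiff 10 k) =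
      y (Fin.succ ⟨k + 1, hk⟩) - y (Fin.succ ⟨k, by omega⟩) := by
    have : k < 9 := by omega
    interval_cases k <;> simp [bil, Fdiff, cls, Fin.sum_univ_succ] <;> ring
  convert h using 1
  · simp [reflect, Fdiff, cls]
  · funext i
    simp only [reflect, hbil, Function.comp_apply, Equiv.swap_apply_def, Fin.ext_iff]
    rcases eq_or_ne (i : ℕ) k with hik | hik
    · obtain rfl : i = ⟨k, Nat.lt_of_succ_lt hk⟩ := Fin.ext hik
      simp [Fdiff, cls]
    · rcases eq_or_ne (i : ℕ) (k + 1) with hik' | hik'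
      · obtain rfl : i = ⟨k + 1, hk⟩ := Fin.ext hik'
        simp [Fdiff, cls]
      · simp [Fdiff, cls, hik, hik']

lemma reflect_reflect {n r : ℕ} {R : PicL r} (hR : bil n r R R = -2) (D : PicL r) :
    reflect n r R (reflect n r R D) = D := by
  have hbil : ∀ c : ℤ, bil n r (D + c • R) R = bil n r D R + c * bil n r R R := by
    intro c
    simp only [bil, Pi.add_apply, Pi.smul_apply, smul_eq_mul, add_mul, Finset.sum_add_distrib,
      mul_assoc, ← Finset.mul_sum]
    ring
  simp only [reflect, hbil, hR]
  rw [add_assoc, ← add_smul]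
  ring_nf

lemma isExceptionalType_apply_iff {w : PicL 10 ≃ₗ[ℤ] PicL 10} (hw : w ∈ Wgrp 2 10)
    (y : PicL 10) : IsExceptionalType (w y) ↔ IsExceptionalType y := by
  induction hw using Subgroup.closure_induction generalizing y with
  | mem g hg =>
    rcases hg with hg | ⟨k, hk, hg⟩
    · rw [hg]
      refine ⟨fun h => ?_, fun h => h.reflect_Fcl⟩
      simpa only [reflect_reflect (show bil 2 10 (Fcl 2 10) (Fcl 2 10) = -2 by decide)]
        using h.reflect_Fcl
    · rw [hg]
      refine ⟨fun h => ?_, fun h => h.reflect_Fdiff hk⟩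
      have hR : bil 2 10 (Fdiff 10 k) (Fdiff 10 k) = -2 := by
        have : k < 9 := by omega
        interval_cases k <;> decide
      simpa only [reflect_reflect hR] using h.reflect_Fdiff hk
  | one => rfl
  | mul a b _ _ ha hb => exact (ha (b y)).trans (hb y)
  | inv a _ ha =>
    rw [← ha]
    exact iff_of_eq (congrArg _ (a.apply_symm_apply y))

lemma nonnegOnExceptional_restMult {d : ℤ} {m : Fin 9 → ℤ}
    (hdm : m 0 ≤ d) (hmono : Antitone m) (hpos : ∀ i, 0 ≤ m i)
    (hstd : m 0 + m 1 + m 2 + m 3 ≤ 2 * d) :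
    NonnegOnExceptional (2 * d - m 0) (restMult d m) := by
  have h01 : m 1 ≤ m 0 := hmono (by decide)
  have h12 : m 2 ≤ m 1 := hmono (by decide)
  have h23 : m 3 ≤ m 2 := hmono (by decide)
  have hle3 : ∀ i : Fin 9, 3 ≤ i → m i ≤ m 3 := fun i hi => hmono hi
  have h4 := hle3 4 (by decide)
  have h5 := hle3 5 (by decide)
  have h6 := hle3 6 (by decide)
  have h7 := hle3 7 (by decide)
  have h8 := hle3 8 (by decide)
  have vals : restMult d m =
      ![d - m 0, d - m 0, m 1, m 2, m 3, m 4, m 5, m 6, m 7, m 8] := by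
    funext i
    fin_cases i <;> rfl
  rw [vals]
  rcases le_or_gt (m 1 + m 2) d with h | h
  · refine nonnegOnExceptional_of_triple_le ?_ ?_
    · intro i
      fin_cases i <;> simp [hpos, hdm]
    · set n := ![d - m 0, d - m 0, m 1, m 2, m 3, m 4, m 5, m 6, m 7, m 8] with hn
      have hcases : ∀ l : Fin 10, ((l : ℕ) = 0 ∧ n l = d - m 0) ∨ ((l : ℕ) = 1 ∧ n l = d - m 0) ∨
          ((l : ℕ) = 2 ∧ n l = m 1) ∨ ((l : ℕ) = 3 ∧ n l = m 2) ∨ n l ≤ m 3 := by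
        intro l
        fin_cases l <;> simp [hn, h4, h5, h6, h7, h8]
      intro i j k hij hik hjk
      rw [Ne, Fin.ext_iff] at hij hik hjk
      rcases hcases i with hi | hi | hi | hi | hi <;>
        rcases hcases j with hj | hj | hj | hj | hj <;>
        rcases hcases k with hk | hk | hk | hk | hk <;> omega
  · refine .of_cremona (χ := ![1, 0, 1, 1, 0, 0, 0, 0, 0, 0]) (t := d - m 1 - m 2)
      (by decide) (by decide) ?_ (nonnegOnExceptional_of_triple_le ?_ ?_)
    · simp [Fin.sum_univ_succ]
      ring
    · intro i
      fin_cases i <;> simp [hpos, hdm] <;> linarith [hpos 3]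
    · set n : Fin 10 → ℤ := fun i =>
        (![d - m 0, d - m 0, m 1, m 2, m 3, m 4, m 5, m 6, m 7, m 8] : Fin 10 → ℤ) i
          + (d - m 1 - m 2) * (![1, 0, 1, 1, 0, 0, 0, 0, 0, 0] : Fin 10 → ℤ) i with hn
      have hcases : ∀ l : Fin 10, ((l : ℕ) = 1 ∧ n l = d - m 0) ∨
          ((l : ℕ) = 2 ∧ n l = d - m 2) ∨ ((l : ℕ) = 3 ∧ n l = d - m 1) ∨
          n l ≤ 2 * d - m 0 - m 1 - m 2 := by
        intro l
        fin_cases l <;> simp [hn] <;> omega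
      intro i j k hij hik hjk
      change n i + n j + n k ≤ _
      rw [Ne, Fin.ext_iff] at hij hik hjk
      rcases hcases i with hi | hi | hi | hi <;>
        rcases hcases j with hj | hj | hj | hj <;>
        rcases hcases k with hk | hk | hk | hk <;> omega

/-- **Proposition of Section 6 (lattice form).** For a standard class
`D = dH - ∑ mᵢEᵢ` on the blow-up of `P³`, the class
`z = (2d-m₁)h - (d-m₁)e₁ - (d-m₁)e₂ - m₂e₃ - ⋯ - m₉e₁₀` of `D|_Q` in the
lattice of the blow-up of `P²` at `10` points has non-negative intersection with
`w(e_j)` for every `w ∈ W'` and every `j`. -/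
theorem stmt14 (d : ℤ) (m : Fin 9 → ℤ)
    (hdm : m 0 ≤ d) (hmono : Antitone m) (hpos : ∀ i, 0 ≤ m i)
    (hstd : m 0 + m 1 + m 2 + m 3 ≤ 2 * d)
    (w : (PicL 10) ≃ₗ[ℤ] (PicL 10)) (hw : w ∈ Wgrp 2 10) (j : Fin 10) :
    0 ≤ bil 2 10 (cls 10 (2 * d - m 0) (restMult d m)) (w (Ecl 10 j)) := by
  have hy := (isExceptionalType_apply_iff hw _).mpr (isExceptionalType_Ecl j)
  have h := nonnegOnExceptional_restMult hdm hmono hpos hstd _ _ hy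
  simpa [bil, cls] using h
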